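/- Consider the real-valued function Λ̃(x) := -1/x + ∫_{1}^{∞} y^{x/2 - 1}·ψ(y) dy for real x ≠ 0. Then: Λ̃ is strictly increasing on (0, ∞) and on (-∞, 0); Λ̃(x) > 0 for all x < 0; Λ̃(x) → +∞ as x → 0⁻; Λ̃(x) → -∞ as x → 0⁺; Λ̃(x) → +∞ as x → +∞. Consequently there is exactly one real number b₀ with Λ̃(b₀) = 0, and 11 < b₀ < 12. -/

import Mathlib

open MeasureTheory Real Filter

/-- For real `y ≥ 1`, `ψ y = ∑_{n ≥ 1} exp (-π n² y)`. -/
noncomputable def psiR (y : ℝ) : ℝ := ∑' n : ℕ, Real.exp (-π * ((n : ℝ) + 1) ^ 2 * y)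

/-- The completed Lavrik function restricted to real arguments. -/
noncomputable def LambdaR (x : ℝ) : ℝ :=
  -1 / x + ∫ y in Set.Ioi (1 : ℝ), y ^ (x / 2 - 1) * psiR y

lemma psiR_term_le (n : ℕ) {y : ℝ} (hy : 1 ≤ y) :
    Real.exp (-π * ((n : ℝ) + 1) ^ 2 * y) ≤ Real.exp (-π * y) * (1 / 100 : ℝ) ^ n := by
  have h1 : Real.exp (-6) ≤ 1 / 100 := by
    have he : (2.7 : ℝ) ≤ Real.exp 1 := by linarith [Real.exp_one_gt_d9]
    have h6 : Real.exp 6 = Real.exp 1 ^ 6 := by rw [← Real.exp_nat_mul]; norm_num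
    have : (2.7 : ℝ) ^ 6 ≤ Real.exp 1 ^ 6 := by gcongr
    rw [Real.exp_neg, h6, inv_eq_one_div]
    exact one_div_le_one_div_of_le (by norm_num) (le_trans (by norm_num) this)
  have hn : (0 : ℝ) ≤ n := n.cast_nonneg
  have h2 : 3 * 1 ≤ π * y := by
    have := Real.pi_gt_three
    gcongr
  calc Real.exp (-π * ((n : ℝ) + 1) ^ 2 * y)
      ≤ Real.exp (-π * y + n * (-6)) := by
        apply Real.exp_le_exp.mpr
        nlinarith [mul_nonneg hn (sub_nonneg.mpr h2), mul_nonneg (mul_nonneg hn hn)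
          (by linarith : (0 : ℝ) ≤ π * y)]
    _ = Real.exp (-π * y) * Real.exp (-6) ^ n := by rw [Real.exp_add, Real.exp_nat_mul]
    _ ≤ _ := by gcongr

lemma summable_psiR_term {y : ℝ} (hy : 1 ≤ y) :
    Summable fun n : ℕ => Real.exp (-π * ((n : ℝ) + 1) ^ 2 * y) :=
  Summable.of_nonneg_of_le (fun _ => (Real.exp_pos _).le) (fun n => psiR_term_le n hy)
    ((summable_geometric_of_lt_one (by norm_num) (by norm_num)).mul_left _)

lemma exp_le_psiR {y : ℝ} (hy : 1 ≤ y) : Real.exp (-π * y) ≤ psiR y := by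
  have := (summable_psiR_term hy).le_tsum 0 (fun _ _ => (Real.exp_pos _).le)
  simpa [psiR] using this

lemma psiR_le_exp {y : ℝ} (hy : 1 ≤ y) : psiR y ≤ 100 / 99 * Real.exp (-π * y) := by
  have hg : Summable fun n : ℕ => (1 / 100 : ℝ) ^ n :=
    summable_geometric_of_lt_one (by norm_num) (by norm_num)
  have := (summable_psiR_term hy).tsum_le_tsum (fun n => psiR_term_le n hy) (hg.mul_left _)
  rw [tsum_mul_left, tsum_geometric_of_lt_one (by norm_num) (by norm_num)] at this
  refine this.trans (le_of_eq ?_)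
  norm_num
  ring

lemma psiR_pos {y : ℝ} (hy : 1 ≤ y) : 0 < psiR y := (Real.exp_pos _).trans_le (exp_le_psiR hy)

lemma antitoneOn_psiR : AntitoneOn psiR (Set.Ioi 1) := by
  intro a ha b hb hab
  refine Summable.tsum_le_tsum (fun n => ?_) (summable_psiR_term (le_of_lt hb))
    (summable_psiR_term (le_of_lt ha))
  apply Real.exp_le_exp.mpr
  have : 0 ≤ π * ((n : ℝ) + 1) ^ 2 := by positivity
  nlinarith

lemma integrableOn_rpow_mul_exp (s : ℝ) :
    IntegrableOn (fun y : ℝ => y ^ s * Real.exp (-π * y)) (Set.Ioi 1) := by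
  refine integrable_of_isBigO_exp_neg (b := π / 2) (by positivity) ?_ ?_
  · refine ContinuousOn.mul ?_ (by fun_prop)
    exact continuousOn_id.rpow_const fun y hy =>
      Or.inl (ne_of_gt (lt_of_lt_of_le one_pos hy))
  · have h := (isLittleO_rpow_exp_pos_mul_atTop s (half_pos Real.pi_pos)).isBigO.mul
      (Asymptotics.isBigO_refl (fun y : ℝ => Real.exp (-π * y)) atTop)
    refine h.congr_right fun y => ?_
    rw [← Real.exp_add]
    ring_nf

lemma aestronglyMeasurable_rpow_mul_psiR (s : ℝ) :
    AEStronglyMeasurable (fun y : ℝ => y ^ s * psiR y) (volume.restrict (Set.Ioi 1)) :=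
  ((Measurable.pow_const measurable_id s).aemeasurable.mul
    (aemeasurable_restrict_of_antitoneOn measurableSet_Ioi antitoneOn_psiR)).aestronglyMeasurable

lemma integrableOn_rpow_mul_psiR (s : ℝ) :
    IntegrableOn (fun y : ℝ => y ^ s * psiR y) (Set.Ioi 1) := by
  refine Integrable.mono' ((integrableOn_rpow_mul_exp s).const_mul (100 / 99))
    (aestronglyMeasurable_rpow_mul_psiR s) ?_
  filter_upwards [ae_restrict_mem measurableSet_Ioi] with y hy
  have hy1 : (1 : ℝ) ≤ y := le_of_lt hy
  have hp : 0 ≤ y ^ s := Real.rpow_nonneg (by linarith) s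
  rw [Real.norm_of_nonneg (mul_nonneg hp (psiR_pos hy1).le)]
  nlinarith [mul_le_mul_of_nonneg_left (psiR_le_exp hy1) hp]

lemma monotone_integral_rpow_mul_psiR :
    Monotone fun s : ℝ => ∫ y in Set.Ioi (1 : ℝ), y ^ s * psiR y := by
  intro s t hst
  refine setIntegral_mono_on (integrableOn_rpow_mul_psiR s) (integrableOn_rpow_mul_psiR t)
    measurableSet_Ioi fun y hy => ?_
  have hy1 : (1 : ℝ) ≤ y := le_of_lt hy
  have := psiR_pos hy1
  gcongr

lemma integral_rpow_mul_exp_le (s : ℝ) :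
    ∫ y in Set.Ioi (1 : ℝ), y ^ s * Real.exp (-π * y) ≤
      ∫ y in Set.Ioi (1 : ℝ), y ^ s * psiR y := by
  refine setIntegral_mono_on (integrableOn_rpow_mul_exp s) (integrableOn_rpow_mul_psiR s)
    measurableSet_Ioi fun y hy => ?_
  have hy1 : (1 : ℝ) ≤ y := le_of_lt hy
  have : 0 ≤ y ^ s := Real.rpow_nonneg (by linarith) s
  exact mul_le_mul_of_nonneg_left (exp_le_psiR hy1) this

lemma integral_rpow_mul_psiR_pos (s : ℝ) :
    0 < ∫ y in Set.Ioi (1 : ℝ), y ^ s * psiR y := by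
  have hpos : ∀ y ∈ Set.Ioi (1 : ℝ), 0 < y ^ s * psiR y := fun y hy =>
    mul_pos (Real.rpow_pos_of_pos (one_pos.trans hy) s) (psiR_pos (le_of_lt hy))
  rw [setIntegral_pos_iff_support_of_nonneg_ae _ (integrableOn_rpow_mul_psiR s)]
  · have hsub : Set.Ioi (1 : ℝ) ⊆ Function.support fun y : ℝ => y ^ s * psiR y :=
      fun y hy => (hpos y hy).ne'
    rw [Set.inter_eq_right.mpr hsub]
    simp
  · filter_upwards [ae_restrict_mem measurableSet_Ioi] with y hy
    exact (hpos y hy).le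

lemma continuous_integral_rpow_mul_psiR :
    Continuous fun s : ℝ => ∫ y in Set.Ioi (1 : ℝ), y ^ s * psiR y := by
  refine continuous_iff_continuousAt.mpr fun s => ?_
  refine continuousAt_of_dominated (bound := fun y => y ^ (s + 1) * psiR y)
    (Eventually.of_forall aestronglyMeasurable_rpow_mul_psiR) ?_
    (integrableOn_rpow_mul_psiR (s + 1)) ?_
  · filter_upwards [Iio_mem_nhds (lt_add_one s)] with t ht
    filter_upwards [ae_restrict_mem measurableSet_Ioi] with y hy
    have hy1 : (1 : ℝ) ≤ y := le_of_lt hy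
    have hψ := psiR_pos hy1
    rw [Real.norm_of_nonneg (mul_nonneg (Real.rpow_nonneg (by linarith) t) hψ.le)]
    have ht' : t ≤ s + 1 := le_of_lt ht
    gcongr
  · filter_upwards [ae_restrict_mem measurableSet_Ioi] with y hy
    exact (Real.continuousAt_const_rpow (one_pos.trans hy).ne').mul continuousAt_const

lemma integrableOn_pow_mul_exp (k : ℕ) :
    IntegrableOn (fun y : ℝ => y ^ k * Real.exp (-π * y)) (Set.Ioi 1) := by
  simpa using integrableOn_rpow_mul_exp k

lemma integral_exp_neg_pi_mul :
    ∫ y in Set.Ioi (1 : ℝ), y ^ 0 * Real.exp (-π * y) = Real.exp (-π) * (1 / π) := by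
  have h := integral_exp_mul_Ioi (a := -π) (by simp [Real.pi_pos]) 1
  simp only [pow_zero, one_mul]
  rw [h]
  field_simp

lemma integral_pow_succ_mul_exp (k : ℕ) :
    ∫ y in Set.Ioi (1 : ℝ), y ^ (k + 1) * Real.exp (-π * y) =
      Real.exp (-π) * (1 / π) +
        (k + 1) * (1 / π) * ∫ y in Set.Ioi (1 : ℝ), y ^ k * Real.exp (-π * y) := by
  have hder : ∀ y ∈ Set.Ici (1 : ℝ), HasDerivAt (fun y : ℝ => y ^ (k + 1) * Real.exp (-π * y))
      ((k + 1) * (y ^ k * Real.exp (-π * y)) - π * (y ^ (k + 1) * Real.exp (-π * y))) y := by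
    intro y _
    have h1 := hasDerivAt_pow (k + 1) y
    have h2 : HasDerivAt (fun y : ℝ => Real.exp (-π * y)) (Real.exp (-π * y) * (-π * 1)) y :=
      ((hasDerivAt_id y).const_mul (-π)).exp
    refine (h1.mul h2).congr_deriv ?_
    push_cast
    ring
  have hlim : Tendsto (fun y : ℝ => y ^ (k + 1) * Real.exp (-π * y)) atTop (nhds 0) := by
    have := tendsto_rpow_mul_exp_neg_mul_atTop_nhds_zero ((k + 1 : ℕ) : ℝ) π Real.pi_pos
    simpa only [Real.rpow_natCast] using this
  have h := integral_Ioi_of_hasDerivAt_of_tendsto' hder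
    (((integrableOn_pow_mul_exp k).const_mul _).sub
      ((integrableOn_pow_mul_exp (k + 1)).const_mul _)) hlim
  rw [integral_sub ((integrableOn_pow_mul_exp k).const_mul _)
    ((integrableOn_pow_mul_exp (k + 1)).const_mul _), integral_const_mul, integral_const_mul] at h
  simp only [one_pow, one_mul, mul_one] at h
  generalize (∫ y in Set.Ioi (1 : ℝ), y ^ (k + 1) * Real.exp (-π * y)) = J at h ⊢
  generalize (∫ y in Set.Ioi (1 : ℝ), y ^ k * Real.exp (-π * y)) = I at h ⊢
  field_simp
  linarith

lemma integral_pow_four_mul_exp :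
    ∫ y in Set.Ioi (1 : ℝ), y ^ 4 * Real.exp (-π * y) = Real.exp (-π) *
      (1 / π + 4 * (1 / π) ^ 2 + 12 * (1 / π) ^ 3 + 24 * (1 / π) ^ 4 + 24 * (1 / π) ^ 5) := by
  rw [integral_pow_succ_mul_exp 3, integral_pow_succ_mul_exp 2, integral_pow_succ_mul_exp 1,
    integral_pow_succ_mul_exp 0, integral_exp_neg_pi_mul]
  push_cast
  ring

lemma integral_pow_five_mul_exp :
    ∫ y in Set.Ioi (1 : ℝ), y ^ 5 * Real.exp (-π * y) = Real.exp (-π) *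
      (1 / π + 5 * (1 / π) ^ 2 + 20 * (1 / π) ^ 3 + 60 * (1 / π) ^ 4 + 120 * (1 / π) ^ 5
        + 120 * (1 / π) ^ 6) := by
  rw [integral_pow_succ_mul_exp 4, integral_pow_four_mul_exp]
  push_cast
  ring

lemma exp_neg_pi_bounds : 0.0423 ≤ Real.exp (-π) ∧ Real.exp (-π) ≤ 0.0435 := by
  have h3 : Real.exp 3 = Real.exp 1 ^ 3 := by rw [← Real.exp_nat_mul]; norm_num
  have hsplit : Real.exp π = Real.exp 1 ^ 3 * Real.exp (π - 3) := by
    rw [← h3, ← Real.exp_add]; ring_nf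
  have hπ1 := Real.pi_gt_d4
  have hπ2 := Real.pi_lt_d4
  have hlo3 : (2.718 : ℝ) ^ 3 ≤ Real.exp 1 ^ 3 := by
    have : (2.718 : ℝ) ≤ Real.exp 1 := by linarith [Real.exp_one_gt_d9]
    gcongr
  have hhi3 : Real.exp 1 ^ 3 ≤ (2.7183 : ℝ) ^ 3 := by
    have : Real.exp 1 ≤ (2.7183 : ℝ) := by linarith [Real.exp_one_lt_d9]
    gcongr
  have hlo : 1.1497 ≤ Real.exp (π - 3) := by
    have := Real.quadratic_le_exp_of_nonneg (x := π - 3) (by linarith)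
    nlinarith
  have hhi : Real.exp (π - 3) ≤ 1.17 := by
    have h := Real.add_one_le_exp (-(π - 3))
    have hm : Real.exp (-(π - 3)) * Real.exp (π - 3) = 1 := by rw [← Real.exp_add]; simp
    nlinarith [Real.exp_pos (π - 3)]
  have hprod : Real.exp (-π) * Real.exp π = 1 := by rw [← Real.exp_add]; simp
  have hL : 2.718 ^ 3 * 1.1497 ≤ Real.exp π := by
    rw [hsplit]; gcongr
  have hU : Real.exp π ≤ 2.7183 ^ 3 * 1.17 := by
    rw [hsplit]; gcongr
  have hpos := Real.exp_pos (-π)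
  constructor
  · nlinarith
  · nlinarith

lemma one_div_pi_bounds : 0.318 ≤ 1 / π ∧ 1 / π ≤ 0.3185 := by
  constructor
  · rw [le_div_iff₀ Real.pi_pos]; linarith [Real.pi_lt_d4]
  · rw [div_le_iff₀ Real.pi_pos]; linarith [Real.pi_gt_d4]

lemma LambdaR_twelve_pos : 0 < LambdaR 12 := by
  have h := integral_rpow_mul_exp_le (12 / 2 - 1)
  have he : ∫ y in Set.Ioi (1 : ℝ), y ^ ((12 : ℝ) / 2 - 1) * Real.exp (-π * y) =
      ∫ y in Set.Ioi (1 : ℝ), y ^ 5 * Real.exp (-π * y) := by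
    congr 1 with y
    rw [show (12 : ℝ) / 2 - 1 = (5 : ℕ) by norm_num, Real.rpow_natCast]
  rw [he, integral_pow_five_mul_exp] at h
  obtain ⟨he1, -⟩ := exp_neg_pi_bounds
  obtain ⟨hp1, -⟩ := one_div_pi_bounds
  have : (0.0423 : ℝ) * (0.318 + 5 * 0.318 ^ 2 + 20 * 0.318 ^ 3 + 60 * 0.318 ^ 4
      + 120 * 0.318 ^ 5 + 120 * 0.318 ^ 6) ≤ Real.exp (-π) *
      (1 / π + 5 * (1 / π) ^ 2 + 20 * (1 / π) ^ 3 + 60 * (1 / π) ^ 4 + 120 * (1 / π) ^ 5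
        + 120 * (1 / π) ^ 6) := by gcongr
  unfold LambdaR
  norm_num at this h ⊢
  linarith

lemma LambdaR_eleven_neg : LambdaR 11 < 0 := by
  have h : ∫ y in Set.Ioi (1 : ℝ), y ^ ((11 : ℝ) / 2 - 1) * psiR y ≤
      ∫ y in Set.Ioi (1 : ℝ), (200 / 297 * (y ^ 4 * Real.exp (-π * y)) +
        75 / 198 * (y ^ 5 * Real.exp (-π * y))) := by
    refine setIntegral_mono_on (integrableOn_rpow_mul_psiR _)
      (((integrableOn_pow_mul_exp 4).const_mul _).add ((integrableOn_pow_mul_exp 5).const_mul _))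
      measurableSet_Ioi fun y hy => ?_
    have hy1 : (1 : ℝ) ≤ y := le_of_lt hy
    have hy0 : 0 ≤ y := by linarith
    have hr : y ^ ((11 : ℝ) / 2 - 1) = y ^ 4 * √y := by
      rw [show (11 : ℝ) / 2 - 1 = (4 : ℕ) + 1 / 2 by norm_num,
        Real.rpow_add (by linarith), Real.rpow_natCast, Real.sqrt_eq_rpow]
    have hs : √y ≤ 2 / 3 + 3 / 8 * y := by
      nlinarith [Real.sq_sqrt hy0, sq_nonneg (√y - 4 / 3)]
    rw [hr]
    calc y ^ 4 * √y * psiR y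
        ≤ y ^ 4 * (2 / 3 + 3 / 8 * y) * (100 / 99 * Real.exp (-π * y)) := by
          have := psiR_pos hy1
          have := psiR_le_exp hy1
          gcongr
      _ = _ := by ring
  rw [integral_add ((integrableOn_pow_mul_exp 4).const_mul _)
    ((integrableOn_pow_mul_exp 5).const_mul _), integral_const_mul, integral_const_mul,
    integral_pow_four_mul_exp, integral_pow_five_mul_exp] at h
  obtain ⟨-, he2⟩ := exp_neg_pi_bounds
  obtain ⟨-, hp2⟩ := one_div_pi_bounds
  have hπ : 0 ≤ 1 / π := by positivity
  have h4 : Real.exp (-π) *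
      (1 / π + 4 * (1 / π) ^ 2 + 12 * (1 / π) ^ 3 + 24 * (1 / π) ^ 4 + 24 * (1 / π) ^ 5) ≤
      (0.0435 : ℝ) * (0.3185 + 4 * 0.3185 ^ 2 + 12 * 0.3185 ^ 3 + 24 * 0.3185 ^ 4
      + 24 * 0.3185 ^ 5) := by gcongr
  have h5 : Real.exp (-π) *
      (1 / π + 5 * (1 / π) ^ 2 + 20 * (1 / π) ^ 3 + 60 * (1 / π) ^ 4 + 120 * (1 / π) ^ 5
        + 120 * (1 / π) ^ 6) ≤
      (0.0435 : ℝ) * (0.3185 + 5 * 0.3185 ^ 2 + 20 * 0.3185 ^ 3 + 60 * 0.3185 ^ 4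
      + 120 * 0.3185 ^ 5 + 120 * 0.3185 ^ 6) := by gcongr
  unfold LambdaR
  norm_num at h4 h5 h ⊢
  linarith

lemma tendsto_integral_rpow_mul_psiR_atTop :
    Tendsto (fun s : ℝ => ∫ y in Set.Ioi (1 : ℝ), y ^ s * psiR y) atTop atTop := by
  have hint : IntegrableOn (fun y : ℝ => y ^ 1 * Real.exp (-π * y) - y ^ 0 * Real.exp (-π * y))
      (Set.Ioi 1) := (integrableOn_pow_mul_exp 1).sub (integrableOn_pow_mul_exp 0)
  have hval : ∫ y in Set.Ioi (1 : ℝ), (y ^ 1 * Real.exp (-π * y) - y ^ 0 * Real.exp (-π * y)) =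
      Real.exp (-π) * (1 / π) ^ 2 := by
    rw [integral_sub (integrableOn_pow_mul_exp 1) (integrableOn_pow_mul_exp 0),
      integral_pow_succ_mul_exp 0, integral_exp_neg_pi_mul]
    push_cast
    ring
  have hc : 0 < Real.exp (-π) * (1 / π) ^ 2 := by positivity
  refine tendsto_atTop_mono' _ ?_ (tendsto_id.atTop_mul_const hc)
  filter_upwards [eventually_ge_atTop 1] with s hs
  refine le_trans ?_ (integral_rpow_mul_exp_le s)
  rw [← hval, ← integral_const_mul]
  refine setIntegral_mono_on (hint.const_mul _) (integrableOn_rpow_mul_exp s)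
    measurableSet_Ioi fun y hy => ?_
  have hy1 : (1 : ℝ) < y := hy
  have hb := one_add_mul_self_le_rpow_one_add (s := y - 1) (by linarith) hs
  rw [add_sub_cancel] at hb
  calc id s * (y ^ 1 * Real.exp (-π * y) - y ^ 0 * Real.exp (-π * y))
      = (s * (y - 1)) * Real.exp (-π * y) := by simp only [id]; ring
    _ ≤ y ^ s * Real.exp (-π * y) := by gcongr; linarith

lemma LambdaR_lt_of_neg_inv_lt {a b : ℝ} (hab : a < b) (h : b⁻¹ < a⁻¹) :
    LambdaR a < LambdaR b := by
  have hm : ∫ y in Set.Ioi (1 : ℝ), y ^ (a / 2 - 1) * psiR y ≤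
      ∫ y in Set.Ioi (1 : ℝ), y ^ (b / 2 - 1) * psiR y :=
    monotone_integral_rpow_mul_psiR (by linarith)
  simp only [LambdaR, neg_div, one_div]
  linarith

lemma LambdaR_pos_of_nonpos {x : ℝ} (hx : x ≤ 0) : 0 < LambdaR x := by
  have h1 : 0 ≤ -1 / x := div_nonneg_of_nonpos (by norm_num) hx
  have h2 := integral_rpow_mul_psiR_pos (x / 2 - 1)
  exact add_pos_of_nonneg_of_pos h1 h2

lemma strictMonoOn_LambdaR_Ioi : StrictMonoOn LambdaR (Set.Ioi 0) := fun _ ha _ _ hab =>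
  LambdaR_lt_of_neg_inv_lt hab (inv_strictAnti₀ ha hab)

lemma strictMonoOn_LambdaR_Iio : StrictMonoOn LambdaR (Set.Iio 0) := fun _ ha _ hb hab =>
  LambdaR_lt_of_neg_inv_lt hab ((inv_lt_inv_of_neg hb ha).mpr hab)

lemma continuousOn_LambdaR_Ioi : ContinuousOn LambdaR (Set.Ioi 0) := by
  refine ContinuousOn.add (continuousOn_const.div continuousOn_id fun x hx => ne_of_gt hx) ?_
  exact (continuous_integral_rpow_mul_psiR.comp
    (by fun_prop : Continuous fun x : ℝ => x / 2 - 1)).continuousOn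

theorem LambdaR_properties :
    StrictMonoOn LambdaR (Set.Ioi 0)
      ∧ StrictMonoOn LambdaR (Set.Iio 0)
      ∧ (∀ x < (0 : ℝ), 0 < LambdaR x)
      ∧ Tendsto LambdaR (nhdsWithin 0 (Set.Iio 0)) atTop
      ∧ Tendsto LambdaR (nhdsWithin 0 (Set.Ioi 0)) atBot
      ∧ Tendsto LambdaR atTop atTop
      ∧ ∃ b₀ : ℝ, 11 < b₀ ∧ b₀ < 12 ∧ LambdaR b₀ = 0
          ∧ ∀ x : ℝ, LambdaR x = 0 → x = b₀ := by
  have hneg : (HDiv.hDiv (-1 : ℝ) : ℝ → ℝ) = fun x => -x⁻¹ := by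
    funext x
    rw [neg_div, one_div]
  refine ⟨strictMonoOn_LambdaR_Ioi, strictMonoOn_LambdaR_Iio,
    fun x hx => LambdaR_pos_of_nonpos hx.le, ?_, ?_, ?_, ?_⟩
  · refine tendsto_atTop_add_right_of_le' _ 0 ?_
      (Eventually.of_forall fun x => (integral_rpow_mul_psiR_pos (x / 2 - 1)).le)
    rw [hneg]
    exact tendsto_neg_atBot_atTop.comp tendsto_inv_nhdsLT_zero
  · refine tendsto_atBot_add_right_of_ge' _
      (∫ y in Set.Ioi (1 : ℝ), y ^ (0 : ℝ) * psiR y) ?_ ?_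
    · rw [hneg]
      exact tendsto_neg_atTop_atBot.comp tendsto_inv_nhdsGT_zero
    · filter_upwards [nhdsWithin_le_nhds (Iio_mem_nhds two_pos)] with x hx
      have hx2 : x < 2 := hx
      exact monotone_integral_rpow_mul_psiR (by linarith)
  · refine tendsto_atTop_add_left_of_le' _ (-1) ?_ ?_
    · filter_upwards [eventually_ge_atTop 1] with x hx
      rw [neg_div, neg_le_neg_iff]
      exact (div_le_one (by linarith)).mpr hx
    · exact tendsto_integral_rpow_mul_psiR_atTop.comp
        (tendsto_atTop_add_const_right _ _ (tendsto_id.atTop_div_const two_pos))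
  · obtain ⟨b, ⟨hb1, hb2⟩, hb⟩ := intermediate_value_Ioo (by norm_num : (11 : ℝ) ≤ 12)
      (continuousOn_LambdaR_Ioi.mono fun x hx => lt_of_lt_of_le (by norm_num) hx.1)
      ⟨LambdaR_eleven_neg, LambdaR_twelve_pos⟩
    refine ⟨b, hb1, hb2, hb, fun x hx => ?_⟩
    rcases le_or_gt x 0 with h | h
    · exact absurd hx (LambdaR_pos_of_nonpos h).ne'
    · exact strictMonoOn_LambdaR_Ioi.injOn h (lt_trans (by norm_num) hb1) (hx.trans hb.symm)
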